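/- Under the FedDyn process with possibly nonconvex L_k, assume ℓ is bounded below with infimum ℓ_*, assume each initial device model θ_k^0 satisfies ∇L_k(θ_k^0) = 0, and assume α ≥ 20·L·(m/P). Then E[ (1/T) ∑_{t=1}^T ‖∇ℓ(γ^{t−1})‖² ] ≤ (1/T) · ( 3·α·( ℓ(θ^0) − ℓ_* ) + 30·L³·(m/P)·(1/α) · (1/m) ∑_{k=1}^m ‖θ_k^0 − θ^0‖² ). -/

import Mathlib

open scoped RealInnerProductSpace

set_option linter.unusedSectionVars false

section helpers
variable {E : Type*} [NormedAddCommGroup E] [InnerProductSpace ℝ E]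

theorem fd_descent [CompleteSpace E] (f : E → ℝ) (f' : E → E) (L : ℝ)
    (hf : ∀ x, HasGradientAt f (f' x) x)
    (hs : ∀ x y, ‖f' x - f' y‖ ≤ L * ‖x - y‖) (x y : E) :
    f y ≤ f x + ⟪f' x, y - x⟫ + L / 2 * ‖y - x‖ ^ 2 := by
  set v := y - x with hv
  have hline : ∀ s : ℝ, HasDerivAt (fun s : ℝ => x + s • v) v s := by
    intro s
    simpa using ((hasDerivAt_id s).smul_const v).const_add x
  have hd : ∀ s : ℝ, HasDerivAt
      (fun s : ℝ => f (x + s • v) - s * ⟪f' x, v⟫ - L / 2 * ‖v‖ ^ 2 * s ^ 2)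
      (⟪f' (x + s • v), v⟫ - ⟪f' x, v⟫ - L * ‖v‖ ^ 2 * s) s := by
    intro s
    have h1 := (hf (x + s • v)).hasFDerivAt.comp_hasDerivAt s (hline s)
    have h2 := (hasDerivAt_id s).mul_const (⟪f' x, v⟫)
    have h3 := ((hasDerivAt_id s).pow 2).const_mul (L / 2 * ‖v‖ ^ 2)
    have h4 := (h1.sub h2).sub h3
    refine (h4.congr_deriv ?_)
    simp [InnerProductSpace.toDual_apply_apply]
    ring
  have hanti : AntitoneOn
      (fun s : ℝ => f (x + s • v) - s * ⟪f' x, v⟫ - L / 2 * ‖v‖ ^ 2 * s ^ 2) (Set.Icc 0 1) := by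
    apply antitoneOn_of_deriv_nonpos (convex_Icc 0 1)
    · exact fun s _ => (hd s).continuousAt.continuousWithinAt
    · exact fun s _ => (hd s).differentiableAt.differentiableWithinAt
    · intro s hs'
      rw [interior_Icc] at hs'
      rw [(hd s).deriv, ← inner_sub_left]
      have h1 : ⟪f' (x + s • v) - f' x, v⟫ ≤ ‖f' (x + s • v) - f' x‖ * ‖v‖ := real_inner_le_norm _ _
      have h2 := hs (x + s • v) x
      have h3 : ‖x + s • v - x‖ = s * ‖v‖ := by
        rw [add_sub_cancel_left, norm_smul, Real.norm_of_nonneg hs'.1.le]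
      rw [h3] at h2
      nlinarith [mul_le_mul_of_nonneg_right h2 (norm_nonneg v)]
  have := hanti (Set.left_mem_Icc.2 zero_le_one) (Set.right_mem_Icc.2 zero_le_one) zero_le_one
  simp at this
  have hxy : x + v = y := by simp [hv]
  rw [hxy] at this
  linarith

/-- Jensen for the squared norm of a finite average. -/
theorem fd_jensen {ι : Type*} (s : Finset ι) (v : ι → E) (n : ℝ) (hn : 0 < n)
    (hs : (s.card : ℝ) = n) :
    ‖n⁻¹ • ∑ i ∈ s, v i‖ ^ 2 ≤ n⁻¹ * ∑ i ∈ s, ‖v i‖ ^ 2 := by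
  have h1 : ‖∑ i ∈ s, v i‖ ^ 2 ≤ n * ∑ i ∈ s, ‖v i‖ ^ 2 := by
    calc ‖∑ i ∈ s, v i‖ ^ 2 ≤ (∑ i ∈ s, ‖v i‖) ^ 2 := by gcongr; exact norm_sum_le _ _
      _ ≤ s.card * ∑ i ∈ s, ‖v i‖ ^ 2 := sq_sum_le_card_mul_sum_sq
      _ = _ := by rw [hs]
  rw [norm_smul, mul_pow, Real.norm_of_nonneg (by positivity)]
  calc n⁻¹ ^ 2 * ‖∑ i ∈ s, v i‖ ^ 2 ≤ n⁻¹ ^ 2 * (n * ∑ i ∈ s, ‖v i‖ ^ 2) := by gcongr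
    _ = _ := by field_simp

/-- variance bound -/
theorem fd_var {ι : Type*} (s : Finset ι) (v : ι → E) (n : ℝ) (hn : 0 < n)
    (hs : (s.card : ℝ) = n) :
    n⁻¹ * ∑ i ∈ s, ‖v i - n⁻¹ • ∑ j ∈ s, v j‖ ^ 2 ≤ n⁻¹ * ∑ i ∈ s, ‖v i‖ ^ 2 := by
  set a := n⁻¹ • ∑ j ∈ s, v j with ha
  have hsum : ∑ j ∈ s, v j = n • a := by rw [ha, smul_smul, mul_inv_cancel₀ hn.ne', one_smul]
  have : ∑ i ∈ s, ‖v i - a‖ ^ 2 = ∑ i ∈ s, ‖v i‖ ^ 2 - n * ‖a‖ ^ 2 := by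
    simp_rw [norm_sub_sq_real]
    rw [Finset.sum_add_distrib, Finset.sum_sub_distrib, ← Finset.mul_sum, ← sum_inner, hsum]
    simp [inner_smul_left, hs]
    ring
  rw [this]
  gcongr
  have : 0 ≤ n * ‖a‖ ^ 2 := by positivity
  linarith

theorem fd_three (a b c : E) : ‖a - b - c‖ ^ 2 ≤ 3 * (‖a‖ ^ 2 + ‖b‖ ^ 2 + ‖c‖ ^ 2) := by
  have h : ‖a - b - c‖ ≤ ‖a‖ + ‖b‖ + ‖c‖ :=
    (norm_sub_le _ _).trans (by gcongr; exact norm_sub_le _ _)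
  have := pow_le_pow_left₀ (norm_nonneg _) h 2
  nlinarith [sq_nonneg (‖a‖ - ‖b‖), sq_nonneg (‖b‖ - ‖c‖), sq_nonneg (‖a‖ - ‖c‖)]

theorem fd_young (a b : E) (c : ℝ) (hc : 0 < c) :
    ‖a - b‖ ^ 2 ≤ (1 + c) * ‖a‖ ^ 2 + (1 + c⁻¹) * ‖b‖ ^ 2 := by
  have h := pow_le_pow_left₀ (norm_nonneg _) (norm_sub_le a b) 2
  have h2 : 2 * (‖a‖ * ‖b‖) ≤ c * ‖a‖ ^ 2 + c⁻¹ * ‖b‖ ^ 2 := by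
    have : 0 ≤ c⁻¹ * (c * ‖a‖ - ‖b‖) ^ 2 := by positivity
    have e : c⁻¹ * (c * ‖a‖ - ‖b‖) ^ 2 = c * ‖a‖ ^ 2 + c⁻¹ * ‖b‖ ^ 2 - 2 * (‖a‖ * ‖b‖) := by
      field_simp; ring
    linarith
  nlinarith

theorem fd_count (m P : ℕ) (f : Fin m → ℝ) (hm : 0 < m) :
    ∑ S : {S : Finset (Fin m) // S.card = P}, ∑ k ∈ S.1, f k =
      (Fintype.card {S : Finset (Fin m) // S.card = P} : ℝ) * (P / m) * ∑ k, f k := by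
  classical
  set ι := {S : Finset (Fin m) // S.card = P}
  let c : Fin m → ℝ := fun k => ∑ S : ι, if k ∈ S.1 then 1 else 0
  have hsym : ∀ i j, c i = c j := by
    intro i j
    let σ := Equiv.swap i j
    let e : ι ≃ ι := (Equiv.finsetCongr σ).subtypeEquiv (by intro a; simp)
    apply Fintype.sum_equiv e
    intro S
    have : i ∈ S.1 ↔ j ∈ (e S).1 := by
      simp [e, Equiv.subtypeEquiv, σ, Equiv.finsetCongr]
    simp [this]
  have hex : ∀ f : Fin m → ℝ, ∑ S : ι, ∑ k ∈ S.1, f k = ∑ k, c k * f k := by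
    intro f
    simp only [c, Finset.sum_mul]
    rw [Finset.sum_comm]
    refine Finset.sum_congr rfl fun S _ => ?_
    simp [Finset.sum_ite_mem]
  let k0 : Fin m := ⟨0, hm⟩
  have h1 := hex (fun _ => 1)
  have hc : ∀ k, c k = c k0 := fun k => hsym _ _
  have h2 : (Fintype.card ι : ℝ) * P = m * c k0 := by
    have e : ∀ S : ι, ∑ k ∈ S.1, (1:ℝ) = P := by intro S; simp [S.2]
    simp only [e, hc] at h1
    simpa using h1
  rw [hex]
  simp only [hc]
  rw [← Finset.mul_sum]
  have : c k0 = (Fintype.card ι : ℝ) * (P / m) := by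
    have : (m:ℝ) ≠ 0 := by positivity
    field_simp
    linarith
  rw [this]

set_option maxHeartbeats 1000000 in
theorem fd_arith (α L q p G C e ip : ℝ) (hα : 0 < α) (hL : 0 < L) (hp : 0 < p) (hp1 : p ≤ 1)
    (hq : q = p⁻¹) (hc : 20 * L * q ≤ α) (hG : 0 ≤ G) (hC : 0 ≤ C) (he : 0 ≤ e)
    (h1 : α ^ 2 * e ≤ 3 * (L ^ 2 * C + L ^ 2 * e + G))
    (h2 : α * ip ≤ - G / 2 + L ^ 2 * e / 2) :
    ip + L / 2 * e + (10 * L ^ 3 * q / α ^ 2) *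
      ((1 + p / 2) * ((1 - p) * C + p * e) + (1 + (p / 2)⁻¹) * e - C) + G / (3 * α) ≤ 0 := by
  have hq1 : 1 ≤ q := by rw [hq]; exact (one_le_inv₀ hp).2 hp1
  have hpq : p * q = 1 := by rw [hq]; exact mul_inv_cancel₀ hp.ne'
  have hLα : 20 * L ≤ α := by nlinarith
  have hpi : (p / 2)⁻¹ = 2 * q := by rw [hq]; field_simp
  rw [hpi]
  obtain ⟨r, hr⟩ : ∃ r, r = L / α := ⟨_, rfl⟩
  have hr0 : 0 < r := by rw [hr]; positivity
  have hLr : L = r * α := by rw [hr]; field_simp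
  have hrq : 20 * (r * q) ≤ 1 := by
    rw [hLr] at hc
    by_contra hh; push Not at hh; nlinarith
  have hK : 10 * L ^ 3 * q / α ^ 2 = 10 * L * r ^ 2 * q := by rw [hr]; field_simp
  rw [hK]
  have hr20 : 20 * r ≤ 1 := by nlinarith
  -- bracket
  have hb : (1 + p / 2) * ((1 - p) * C + p * e) + (1 + 2 * q) * e - C
      ≤ - (p / 2) * C + 9 / 2 * q * e := by
    have t1 : (1 + p / 2) * (1 - p) * C ≤ (1 - p / 2) * C := by
      apply mul_le_mul_of_nonneg_right _ hC; nlinarith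
    have t2 : ((1 + p / 2) * p + 1 + 2 * q) * e ≤ 9 / 2 * q * e := by
      apply mul_le_mul_of_nonneg_right _ he; nlinarith
    nlinarith
  have hb2 : 10 * L * r ^ 2 * q * ((1 + p / 2) * ((1 - p) * C + p * e) + (1 + 2 * q) * e - C) ≤
      - 5 * L * r ^ 2 * C + 9 / 80 * L * e := by
    have k1 := mul_le_mul_of_nonneg_left hb (show 0 ≤ 10 * L * r ^ 2 * q by positivity)
    have k2 : 10 * L * r ^ 2 * q * (- (p / 2) * C + 9 / 2 * q * e) =
        - 5 * L * r ^ 2 * C * (p * q) + 45 * (L * e) * (r * q) ^ 2 := by ring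
    have k3 : (r * q) ^ 2 ≤ 1 / 400 := by nlinarith [mul_pos hr0 (lt_of_lt_of_le one_pos hq1)]
    rw [k2, hpq] at k1
    nlinarith [mul_le_mul_of_nonneg_left k3 (show 0 ≤ 45 * (L * e) by positivity)]
  have hip : ip ≤ - G / (2 * α) + 1 / 40 * (L * e) := by
    have : ip ≤ (- G / 2 + L ^ 2 * e / 2) / α := by rw [le_div_iff₀ hα]; linarith
    have e2 : (- G / 2 + L ^ 2 * e / 2) / α = - G / (2 * α) + r * (L * e) / 2 := by
      rw [hr]; field_simp
    have : r * (L * e) ≤ 1 / 20 * (L * e) := by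
      apply mul_le_mul_of_nonneg_right _ (by positivity); linarith
    linarith
  -- bound on e
  have hebd : 397 / 400 * e ≤ 3 * (r ^ 2 * C + G / α ^ 2) := by
    have : e ≤ 3 * (r ^ 2 * C + r ^ 2 * e + G / α ^ 2) := by
      have : 3 * (r ^ 2 * C + r ^ 2 * e + G / α ^ 2) = 3 * (L ^ 2 * C + L ^ 2 * e + G) / α ^ 2 := by
        rw [hr]; field_simp
      rw [this, le_div_iff₀ (by positivity)]; linarith
    have k3 : r ^ 2 ≤ 1 / 400 := by nlinarith
    nlinarith [mul_le_mul_of_nonneg_right k3 he]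
  have hLe := mul_le_mul_of_nonneg_left hebd hL.le
  have hGG : L * (G / α ^ 2) ≤ 1 / 20 * (G / α) := by
    have : L * (G / α ^ 2) = r * (G / α) := by rw [hr]; field_simp
    rw [this]
    apply mul_le_mul_of_nonneg_right _ (by positivity); linarith
  have hGa : 0 ≤ G / α := by positivity
  have e3 : - G / (2 * α) = - (1 / 2) * (G / α) := by
    rw [mul_comm 2 α, ← div_div]; ring
  have e4 : G / (3 * α) = 1 / 3 * (G / α) := by field_simp
  have hX : 0 ≤ L * r ^ 2 * C := by positivity
  rw [e3] at hip
  rw [e4]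
  nlinarith


theorem fd_step [CompleteSpace E] (m P : ℕ) (hP1 : 1 ≤ P) (hPm : P ≤ m)
    (α L : ℝ) (hα : 0 < α) (hL : 0 < L) (hαc : 20 * L * ((m : ℝ) / P) ≤ α)
    (F : Fin m → E → E) (hF : ∀ k x y, ‖F k x - F k y‖ ≤ L * ‖x - y‖)
    (ℓ : E → ℝ) (D : E → E) (hD : ∀ x, D x = (m : ℝ)⁻¹ • ∑ k, F k x)
    (hℓ : ∀ x, HasGradientAt ℓ (D x) x)
    (γ θ h : E) (dev td : Fin m → E)
    (hh : h = (m : ℝ)⁻¹ • ∑ k, F k (dev k))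
    (hθ : θ = γ - α⁻¹ • h)
    (htd : ∀ k, F k (td k) - F k (dev k) + α • (td k - θ) = 0)
    (γ' : {S : Finset (Fin m) // S.card = P} → E)
    (dev' : {S : Finset (Fin m) // S.card = P} → Fin m → E)
    (hγ' : ∀ S, γ' S = (P : ℝ)⁻¹ • ∑ k ∈ S.1, td k)
    (hdev1 : ∀ S, ∀ k ∈ S.1, dev' S k = td k)
    (hdev2 : ∀ S, ∀ k ∉ S.1, dev' S k = dev k) :
    ∑ S, (ℓ (γ' S) + (10 * L ^ 3 * ((m : ℝ) / P) / α ^ 2) *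
        ((m : ℝ)⁻¹ * ∑ k, ‖dev' S k - γ' S‖ ^ 2)
      - (ℓ γ + (10 * L ^ 3 * ((m : ℝ) / P) / α ^ 2) * ((m : ℝ)⁻¹ * ∑ k, ‖dev k - γ‖ ^ 2))
      + ‖D γ‖ ^ 2 / (3 * α)) ≤ 0 := by
  classical
  have hP0 : (0 : ℝ) < P := by exact_mod_cast hP1
  have hm0 : (0 : ℝ) < m := by exact_mod_cast (lt_of_lt_of_le hP1 hPm)
  have hPm' : (P : ℝ) ≤ m := by exact_mod_cast hPm
  have hcardm : ((Finset.univ : Finset (Fin m)).card : ℝ) = m := by simp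
  obtain ⟨p, hp⟩ : ∃ p : ℝ, p = (P : ℝ) / m := ⟨_, rfl⟩
  have hp0 : 0 < p := by rw [hp]; positivity
  have hp1 : p ≤ 1 := by rw [hp]; exact (div_le_one hm0).2 hPm'
  have hpq : (m : ℝ) / P = p⁻¹ := by rw [hp, inv_div]
  rw [hpq] at hαc ⊢
  obtain ⟨K, hK⟩ : ∃ K : ℝ, K = 10 * L ^ 3 * p⁻¹ / α ^ 2 := ⟨_, rfl⟩
  have hK0 : 0 ≤ K := by rw [hK]; positivity
  obtain ⟨e, he⟩ : ∃ e : ℝ, e = (m : ℝ)⁻¹ * ∑ k, ‖td k - γ‖ ^ 2 := ⟨_, rfl⟩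
  obtain ⟨C, hC⟩ : ∃ C : ℝ, C = (m : ℝ)⁻¹ * ∑ k, ‖dev k - γ‖ ^ 2 := ⟨_, rfl⟩
  obtain ⟨ip, hip⟩ : ∃ ip : ℝ, ip = (m : ℝ)⁻¹ * ∑ k, ⟪D γ, td k - γ⟫ := ⟨_, rfl⟩
  have he0 : 0 ≤ e := by rw [he]; positivity
  have hC0 : 0 ≤ C := by rw [hC]; positivity
  -- key formula
  have hkey : ∀ k, α • (td k - γ) = F k (dev k) - F k (td k) - h := by
    intro k
    have h1 := htd k
    have h2 : α • (td k - γ) = α • (td k - θ) - h := by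
      rw [hθ, ← sub_add, smul_add, smul_smul, mul_inv_cancel₀ hα.ne', one_smul,
        add_sub_cancel_right]
    rw [h2, eq_neg_of_add_eq_zero_right h1]
    abel
  have hFsq : ∀ k x y, ‖F k x - F k y‖ ^ 2 ≤ L ^ 2 * ‖x - y‖ ^ 2 := by
    intro k x y
    rw [← mul_pow]
    exact pow_le_pow_left₀ (norm_nonneg _) (hF k x y) 2
  -- bound for e
  have h1 : α ^ 2 * e ≤ 3 * (L ^ 2 * C + L ^ 2 * e + ‖D γ‖ ^ 2) := by
    let X : Fin m → E := fun k => F k (dev k) - F k γ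
    have hX : (m : ℝ)⁻¹ • ∑ k, X k = h - D γ := by
      simp only [X, Finset.sum_sub_distrib, smul_sub, ← hD, ← hh]
    have hk : ∀ k, α ^ 2 * ‖td k - γ‖ ^ 2 ≤
        3 * (‖X k - (m : ℝ)⁻¹ • ∑ k, X k‖ ^ 2 + L ^ 2 * ‖td k - γ‖ ^ 2 + ‖D γ‖ ^ 2) := by
      intro k
      have e1 : α ^ 2 * ‖td k - γ‖ ^ 2 = ‖α • (td k - γ)‖ ^ 2 := by
        rw [norm_smul, mul_pow, Real.norm_of_nonneg hα.le]
      have e2 : α • (td k - γ) = (X k - (m : ℝ)⁻¹ • ∑ k, X k) - (F k (td k) - F k γ) - D γ := by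
        rw [hkey, hX]; simp only [X]; abel
      rw [e1, e2]
      refine (fd_three _ _ _).trans ?_
      have := hFsq k (td k) γ
      linarith
    have hv := fd_var Finset.univ X m hm0 hcardm
    have hX2 : (m : ℝ)⁻¹ * ∑ k, ‖X k‖ ^ 2 ≤ L ^ 2 * C := by
      rw [hC, mul_left_comm, Finset.mul_sum (s := Finset.univ) (a := L ^ 2)]
      gcongr with k
      exact hFsq _ _ _
    have hs := Finset.sum_le_sum fun k (_ : k ∈ (Finset.univ : Finset (Fin m))) => hk k
    have hs2 := mul_le_mul_of_nonneg_left hs (inv_nonneg.2 hm0.le)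
    rw [← Finset.mul_sum, ← Finset.mul_sum, Finset.sum_add_distrib, Finset.sum_add_distrib,
      ← Finset.mul_sum, Finset.sum_const, Finset.card_univ, Fintype.card_fin, nsmul_eq_mul] at hs2
    have e3 : (m : ℝ)⁻¹ * (m * ‖D γ‖ ^ 2) = ‖D γ‖ ^ 2 := by field_simp
    have e4 : α ^ 2 * e = (m : ℝ)⁻¹ * (α ^ 2 * ∑ k, ‖td k - γ‖ ^ 2) := by rw [he]; ring
    have e5 : L ^ 2 * e = (m : ℝ)⁻¹ * (L ^ 2 * ∑ k, ‖td k - γ‖ ^ 2) := by rw [he]; ring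
    rw [e4, e5]
    refine hs2.trans ?_
    have := hv.trans hX2
    nlinarith
  -- inner product
  have h2 : α * ip ≤ - ‖D γ‖ ^ 2 / 2 + L ^ 2 * e / 2 := by
    have e1 : α * ip = - ⟪D γ, (m : ℝ)⁻¹ • ∑ k, F k (td k)⟫ := by
      rw [hip, ← inner_sum, ← inner_smul_right, ← inner_smul_right, ← inner_neg_right]
      congr 1
      rw [smul_comm, Finset.smul_sum]
      simp only [hkey]
      rw [Finset.sum_sub_distrib, Finset.sum_sub_distrib, smul_sub, smul_sub, ← hh]
      simp only [Finset.sum_const, Finset.card_univ, Fintype.card_fin]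
      rw [← Nat.cast_smul_eq_nsmul ℝ, smul_smul, inv_mul_cancel₀ hm0.ne', one_smul]
      abel
    have e2 : ‖D γ - (m : ℝ)⁻¹ • ∑ k, F k (td k)‖ ^ 2 ≤ L ^ 2 * e := by
      have : D γ - (m : ℝ)⁻¹ • ∑ k, F k (td k) = (m : ℝ)⁻¹ • ∑ k, (F k γ - F k (td k)) := by
        rw [Finset.sum_sub_distrib, smul_sub, hD]
      rw [this]
      refine (fd_jensen Finset.univ _ m hm0 hcardm).trans ?_
      rw [he, mul_left_comm, Finset.mul_sum (s := Finset.univ) (a := L ^ 2)]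
      gcongr with k
      rw [norm_sub_rev (td k)]
      exact hFsq _ _ _
    rw [e1]
    have := norm_sub_sq_real (D γ) ((m : ℝ)⁻¹ • ∑ k, F k (td k))
    nlinarith [sq_nonneg ‖(m : ℝ)⁻¹ • ∑ k, F k (td k)‖]
  have harith := fd_arith α L p⁻¹ p (‖D γ‖ ^ 2) C e ip hα hL hp0 hp1 rfl hαc (by positivity)
    hC0 he0 h1 h2
  rw [← hK] at harith ⊢
  rw [← hC]
  -- smoothness of ℓ
  have hDs : ∀ x y, ‖D x - D y‖ ≤ L * ‖x - y‖ := by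
    intro x y
    rw [hD, hD, ← smul_sub, ← Finset.sum_sub_distrib, norm_smul,
      Real.norm_of_nonneg (inv_nonneg.2 hm0.le)]
    calc (m : ℝ)⁻¹ * ‖∑ k, (F k x - F k y)‖ ≤ (m : ℝ)⁻¹ * ∑ k : Fin m, L * ‖x - y‖ := by
          gcongr
          exact (norm_sum_le _ _).trans (Finset.sum_le_sum fun k _ => hF k x y)
      _ = L * ‖x - y‖ := by simp; field_simp
  -- pointwise bound
  have hγd : ∀ S, γ' S - γ = (P : ℝ)⁻¹ • ∑ k ∈ S.1, (td k - γ) := by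
    intro S
    rw [Finset.sum_sub_distrib, smul_sub, ← hγ', Finset.sum_const, S.2,
      ← Nat.cast_smul_eq_nsmul ℝ, smul_smul, inv_mul_cancel₀ hP0.ne', one_smul]
  let W : {S : Finset (Fin m) // S.card = P} → ℝ :=
    fun S => (P : ℝ)⁻¹ * ∑ k ∈ S.1, ‖td k - γ‖ ^ 2
  have hW : ∀ S, ‖γ' S - γ‖ ^ 2 ≤ W S := by
    intro S
    rw [hγd]
    exact fd_jensen S.1 _ P hP0 (by rw [S.2])
  have hpt : ∀ S, ℓ (γ' S) + K * ((m : ℝ)⁻¹ * ∑ k, ‖dev' S k - γ' S‖ ^ 2) - (ℓ γ + K * C)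
      + ‖D γ‖ ^ 2 / (3 * α) ≤
      (∑ k ∈ S.1, ((P : ℝ)⁻¹ * ⟪D γ, td k - γ⟫ + (L / 2 + K * (1 + (p / 2)⁻¹)) *
          ((P : ℝ)⁻¹ * ‖td k - γ‖ ^ 2)
        + K * (1 + p / 2) * (m : ℝ)⁻¹ * (‖td k - γ‖ ^ 2 - ‖dev k - γ‖ ^ 2)))
      + (K * (1 + p / 2) * C - K * C + ‖D γ‖ ^ 2 / (3 * α)) := by
    intro S
    have a1 := fd_descent ℓ D L hℓ hDs γ (γ' S)
    have a2 : ⟪D γ, γ' S - γ⟫ = (P : ℝ)⁻¹ * ∑ k ∈ S.1, ⟪D γ, td k - γ⟫ := by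
      rw [hγd, inner_smul_right, inner_sum]
    have a3 : (m : ℝ)⁻¹ * ∑ k, ‖dev' S k - γ' S‖ ^ 2 ≤
        (1 + p / 2) * ((m : ℝ)⁻¹ * ∑ k, ‖dev' S k - γ‖ ^ 2) + (1 + (p / 2)⁻¹) * W S := by
      have hk : ∀ k, ‖dev' S k - γ' S‖ ^ 2 ≤
          (1 + p / 2) * ‖dev' S k - γ‖ ^ 2 + (1 + (p / 2)⁻¹) * W S := by
        intro k
        have := fd_young (dev' S k - γ) (γ' S - γ) (p / 2) (by positivity)
        rw [sub_sub_sub_cancel_right] at this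
        refine this.trans ?_
        gcongr
        exact hW S
      have hs := Finset.sum_le_sum fun k (_ : k ∈ (Finset.univ : Finset (Fin m))) => hk k
      have hs2 := mul_le_mul_of_nonneg_left hs (inv_nonneg.2 hm0.le)
      rw [Finset.sum_add_distrib, ← Finset.mul_sum, Finset.sum_const, Finset.card_univ,
        Fintype.card_fin, nsmul_eq_mul] at hs2
      refine hs2.trans (le_of_eq ?_)
      field_simp
    have a4 : ∑ k, ‖dev' S k - γ‖ ^ 2 =
        ∑ k, ‖dev k - γ‖ ^ 2 + ∑ k ∈ S.1, (‖td k - γ‖ ^ 2 - ‖dev k - γ‖ ^ 2) := by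
      have : ∀ k, ‖dev' S k - γ‖ ^ 2 = ‖dev k - γ‖ ^ 2 +
          (if k ∈ S.1 then (‖td k - γ‖ ^ 2 - ‖dev k - γ‖ ^ 2) else 0) := by
        intro k
        by_cases hk : k ∈ S.1
        · simp [hk, hdev1 S k hk]
        · simp [hk, hdev2 S k hk]
      simp only [this]
      rw [Finset.sum_add_distrib, Finset.sum_ite_mem, Finset.univ_inter]
    rw [a4, mul_add, ← hC] at a3
    have a5 := mul_le_mul_of_nonneg_left a3 hK0
    have a6 := mul_le_mul_of_nonneg_left (hW S) (show 0 ≤ L / 2 by positivity)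
    rw [Finset.sum_add_distrib, Finset.sum_add_distrib, ← Finset.mul_sum, ← Finset.mul_sum,
      ← Finset.mul_sum, ← Finset.mul_sum]
    rw [a2] at a1
    have hWS : W S = (P : ℝ)⁻¹ * ∑ k ∈ S.1, ‖td k - γ‖ ^ 2 := rfl
    rw [← hWS]
    linarith
  refine (Finset.sum_le_sum fun S _ => hpt S).trans ?_
  rw [Finset.sum_add_distrib, fd_count m P _ (by omega), Finset.sum_const, Finset.card_univ,
    nsmul_eq_mul, mul_assoc, ← mul_add]
  apply mul_nonpos_of_nonneg_of_nonpos (by positivity)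
  refine le_trans (le_of_eq ?_) harith
  rw [Finset.sum_add_distrib, Finset.sum_add_distrib, ← Finset.mul_sum, ← Finset.mul_sum,
      ← Finset.mul_sum, ← Finset.mul_sum, Finset.sum_sub_distrib]
  have b1 : ∑ k, ‖td k - γ‖ ^ 2 = m * e := by rw [he]; field_simp
  have b2 : ∑ k, ‖dev k - γ‖ ^ 2 = m * C := by rw [hC]; field_simp
  have b3 : ∑ k, ⟪D γ, td k - γ⟫ = m * ip := by rw [hip]; field_simp
  have b4 : (P : ℝ) = p * m := by rw [hp]; field_simp
  rw [b1, b2, b3, b4]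
  field_simp
  ring

/-- Averaging over one coordinate. -/
theorem fd_avg {T : ℕ} {β : Type*} [Fintype β] (t : Fin T) (Φ : (Fin T → β) → ℝ)
    (h : ∀ ω, ∑ S, Φ (Function.update ω t S) ≤ 0) : ∑ ω, Φ ω ≤ 0 := by
  classical
  rw [← (Equiv.funSplitAt t β).symm.sum_comp, Fintype.sum_prod_type, Finset.sum_comm]
  apply Finset.sum_nonpos
  intro r _
  rcases isEmpty_or_nonempty β with hβ | ⟨⟨S0⟩⟩
  · simp
  · refine le_trans (le_of_eq ?_) (h ((Equiv.funSplitAt t β).symm (S0, r)))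
    refine Finset.sum_congr rfl fun S _ => ?_
    congr 1
    ext j
    by_cases hj : j = t
    · subst hj; simp [Equiv.funSplitAt, Equiv.piSplitAt]
    · simp [Equiv.funSplitAt, Equiv.piSplitAt, hj]

end helpers

/-- FedDyn convergence rate, nonconvex case. -/
theorem feddyn_convergence_nonconvex
    (d m P T : ℕ) (hd : 1 ≤ d) (hm : 1 ≤ m) (hP1 : 1 ≤ P) (hPm : P ≤ m) (hT : 1 ≤ T)
    (α L : ℝ) (hα : 0 < α) (hL : 0 < L) (hαc : 20 * L * ((m : ℝ) / P) ≤ α)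
    (Lk : Fin m → EuclideanSpace ℝ (Fin d) → ℝ)
    (hdiff : ∀ k, Differentiable ℝ (Lk k))
    (hsmooth : ∀ k x y, ‖gradient (Lk k) x - gradient (Lk k) y‖ ≤ L * ‖x - y‖)
    (ℓ : EuclideanSpace ℝ (Fin d) → ℝ)
    (hℓ : ∀ x, ℓ x = (m : ℝ)⁻¹ * ∑ k, Lk k x)
    (lstar : ℝ) (hglb : IsGLB (Set.range ℓ) lstar)
    (θ0 : EuclideanSpace ℝ (Fin d))
    (θdev0 : Fin m → EuclideanSpace ℝ (Fin d))
    (hgrad0 : ∀ k, gradient (Lk k) (θdev0 k) = 0)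
    -- the FedDyn process, as functions of the random sequence of active sets
    (θ : (Fin T → {S : Finset (Fin m) // S.card = P}) → ℕ → EuclideanSpace ℝ (Fin d))
    (θdev : (Fin T → {S : Finset (Fin m) // S.card = P}) → ℕ → Fin m → EuclideanSpace ℝ (Fin d))
    (g : (Fin T → {S : Finset (Fin m) // S.card = P}) → ℕ → Fin m → EuclideanSpace ℝ (Fin d))
    (h : (Fin T → {S : Finset (Fin m) // S.card = P}) → ℕ → EuclideanSpace ℝ (Fin d))
    (γ : (Fin T → {S : Finset (Fin m) // S.card = P}) → ℕ → EuclideanSpace ℝ (Fin d))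
    (hθ0 : ∀ ω, θ ω 0 = θ0)
    (hθdev0 : ∀ ω k, θdev ω 0 k = θdev0 k)
    (hg0 : ∀ ω k, g ω 0 k = 0)
    (hh0 : ∀ ω, h ω 0 = 0)
    -- active devices minimize the dynamically regularized local objective ...
    (hdevmin : ∀ ω (t : Fin T), ∀ k ∈ (ω t).1, ∀ x,
      Lk k (θdev ω (t.1 + 1) k) - ⟪g ω t.1 k, θdev ω (t.1 + 1) k⟫
          + α / 2 * ‖θdev ω (t.1 + 1) k - θ ω t.1‖ ^ 2 ≤
        Lk k x - ⟪g ω t.1 k, x⟫ + α / 2 * ‖x - θ ω t.1‖ ^ 2)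
    (hfoc : ∀ ω (t : Fin T), ∀ k ∈ (ω t).1,
      gradient (Lk k) (θdev ω (t.1 + 1) k) - g ω t.1 k
        + α • (θdev ω (t.1 + 1) k - θ ω t.1) = 0)
    (hgupd : ∀ ω (t : Fin T), ∀ k ∈ (ω t).1,
      g ω (t.1 + 1) k = g ω t.1 k - α • (θdev ω (t.1 + 1) k - θ ω t.1))
    (hstaleθ : ∀ ω (t : Fin T), ∀ k ∉ (ω t).1, θdev ω (t.1 + 1) k = θdev ω t.1 k)
    (hstaleg : ∀ ω (t : Fin T), ∀ k ∉ (ω t).1, g ω (t.1 + 1) k = g ω t.1 k)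
    (hhupd : ∀ ω (t : Fin T),
      h ω (t.1 + 1) = h ω t.1 - (α / m) • ∑ k ∈ (ω t).1, (θdev ω (t.1 + 1) k - θ ω t.1))
    (hθupd : ∀ ω (t : Fin T),
      θ ω (t.1 + 1) = (P : ℝ)⁻¹ • ∑ k ∈ (ω t).1, θdev ω (t.1 + 1) k - α⁻¹ • h ω (t.1 + 1))
    (hγ0 : ∀ ω, γ ω 0 = θ0)
    (hγ : ∀ ω (t : Fin T),
      γ ω (t.1 + 1) = (P : ℝ)⁻¹ • ∑ k ∈ (ω t).1, θdev ω (t.1 + 1) k) :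
    (∑ ω : (Fin T → {S : Finset (Fin m) // S.card = P}),
        (T : ℝ)⁻¹ * ∑ t ∈ Finset.range T, ‖gradient ℓ (γ ω t)‖ ^ 2) /
      (Fintype.card (Fin T → {S : Finset (Fin m) // S.card = P}) : ℝ) ≤
    (T : ℝ)⁻¹ * (3 * α * (ℓ θ0 - lstar) +
      30 * L ^ 3 * ((m : ℝ) / P) * α⁻¹ * ((m : ℝ)⁻¹ * ∑ k, ‖θdev0 k - θ0‖ ^ 2)) := by
  classical
  have hP0 : (0 : ℝ) < P := by exact_mod_cast hP1
  have hm0 : (0 : ℝ) < m := by exact_mod_cast hm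
  have hLα : L < α := by
    have : 1 ≤ (m : ℝ) / P := (one_le_div hP0).2 (by exact_mod_cast hPm)
    nlinarith
  -- gradient of ℓ
  have hHG : ∀ x, HasGradientAt ℓ ((m : ℝ)⁻¹ • ∑ k, gradient (Lk k) x) x := by
    intro x
    have e : ℓ = fun x => (m : ℝ)⁻¹ * ∑ k, Lk k x := funext hℓ
    rw [e, hasGradientAt_iff_hasFDerivAt]
    have h1 := (HasFDerivAt.fun_sum (u := Finset.univ)
      fun k _ => ((hdiff k x).hasGradientAt).hasFDerivAt).const_mul ((m : ℝ)⁻¹)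
    refine h1.congr_fderiv ?_
    simp [map_sum]
  have hgradℓ : ∀ x, gradient ℓ x = (m : ℝ)⁻¹ • ∑ k, gradient (Lk k) x := fun x => (hHG x).gradient
  have hHG' : ∀ x, HasGradientAt ℓ (gradient ℓ x) x := fun x => by rw [hgradℓ]; exact hHG x
  -- uniqueness of local solutions
  have huniq : ∀ k (u c x y : EuclideanSpace ℝ (Fin d)),
      gradient (Lk k) x - u + α • (x - c) = 0 → gradient (Lk k) y - u + α • (y - c) = 0 →
      x = y := by
    intro k u c x y hx hy
    have h1 : gradient (Lk k) x - gradient (Lk k) y = - (α • (x - y)) := by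
      have h2 : (gradient (Lk k) x - u + α • (x - c)) - (gradient (Lk k) y - u + α • (y - c)) = 0 := by
        rw [hx, hy, sub_zero]
      rw [eq_neg_iff_add_eq_zero, ← h2]
      module
    have h2 := hsmooth k x y
    rw [h1, norm_neg, norm_smul, Real.norm_of_nonneg hα.le] at h2
    by_contra hne
    have : 0 < ‖x - y‖ := norm_pos_iff.2 (sub_ne_zero.2 hne)
    nlinarith
  -- invariants
  have hgg : ∀ ω t, t ≤ T → ∀ k, g ω t k = gradient (Lk k) (θdev ω t k) := by
    intro ω t
    induction t with
    | zero => intro _ k; rw [hg0, hθdev0, hgrad0]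
    | succ t ih =>
      intro ht k
      by_cases hk : k ∈ (ω ⟨t, ht⟩).1
      · have h1 := hgupd ω ⟨t, ht⟩ k hk
        have h2 := hfoc ω ⟨t, ht⟩ k hk
        simp only at h1 h2
        rw [h1]
        have : gradient (Lk k) (θdev ω (t + 1) k) =
          (gradient (Lk k) (θdev ω (t + 1) k) - g ω t k + α • (θdev ω (t + 1) k - θ ω t))
            + (g ω t k - α • (θdev ω (t + 1) k - θ ω t)) := by abel
        rw [h2, zero_add] at this
        exact this.symm
      · have h1 := hstaleg ω ⟨t, ht⟩ k hk
        have h2 := hstaleθ ω ⟨t, ht⟩ k hk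
        simp only at h1 h2
        rw [h1, h2]
        exact ih (by omega) k
  have hhm : ∀ ω t, t ≤ T → h ω t = (m : ℝ)⁻¹ • ∑ k, g ω t k := by
    intro ω t
    induction t with
    | zero => intro _; simp [hh0, hg0]
    | succ t ih =>
      intro ht
      have h1 := hhupd ω ⟨t, ht⟩
      simp only at h1
      have h2 : ∀ k, g ω (t + 1) k = g ω t k -
          (if k ∈ (ω ⟨t, ht⟩).1 then α • (θdev ω (t + 1) k - θ ω t) else 0) := by
        intro k
        by_cases hk : k ∈ (ω ⟨t, ht⟩).1
        · simpa [hk] using hgupd ω ⟨t, ht⟩ k hk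
        · simpa [hk] using hstaleg ω ⟨t, ht⟩ k hk
      rw [h1, ih (by omega)]
      simp only [h2]
      rw [Finset.sum_sub_distrib (f := fun k => g ω t k), Finset.sum_ite_mem, Finset.univ_inter,
        ← Finset.smul_sum, smul_sub, smul_smul]
      congr 2
      rw [div_eq_mul_inv, mul_comm]
  have hθγ : ∀ ω t, t ≤ T → θ ω t = γ ω t - α⁻¹ • h ω t := by
    intro ω t ht
    cases t with
    | zero => rw [hθ0, hγ0, hh0, smul_zero, sub_zero]
    | succ t => exact (hθupd ω ⟨t, ht⟩).trans (by rw [← hγ ω ⟨t, ht⟩])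
  -- adaptedness
  have hadapt : ∀ t, t ≤ T → ∀ ω ω', (∀ s : Fin T, s.1 < t → ω s = ω' s) →
      (∀ k, θdev ω t k = θdev ω' t k) ∧ γ ω t = γ ω' t := by
    intro t
    induction t with
    | zero => intro _ ω ω' _; exact ⟨fun k => by rw [hθdev0, hθdev0], by rw [hγ0, hγ0]⟩
    | succ t ih =>
      intro ht ω ω' hω
      obtain ⟨i1, i2⟩ := ih (by omega) ω ω' fun s hs => hω s (by omega)
      have hS : ω ⟨t, ht⟩ = ω' ⟨t, ht⟩ := hω ⟨t, ht⟩ (Nat.lt_succ_self t)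
      have ig : ∀ k, g ω t k = g ω' t k := fun k => by
        rw [hgg ω t (by omega), hgg ω' t (by omega), i1]
      have ih' : h ω t = h ω' t := by
        rw [hhm ω t (by omega), hhm ω' t (by omega)]; simp only [ig]
      have iθ : θ ω t = θ ω' t := by
        rw [hθγ ω t (by omega), hθγ ω' t (by omega), ih', i2]
      have hdev : ∀ k, θdev ω (t + 1) k = θdev ω' (t + 1) k := by
        intro k
        by_cases hk : k ∈ (ω ⟨t, ht⟩).1
        · have h1 := hfoc ω ⟨t, ht⟩ k hk
          have h2 := hfoc ω' ⟨t, ht⟩ k (hS ▸ hk)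
          simp only at h1 h2
          rw [← ig, ← iθ] at h2
          exact huniq k _ _ _ _ h1 h2
        · have h1 := hstaleθ ω ⟨t, ht⟩ k hk
          have h2 := hstaleθ ω' ⟨t, ht⟩ k (hS ▸ hk)
          simp only at h1 h2
          rw [h1, h2, i1]
      refine ⟨hdev, ?_⟩
      have h1 := hγ ω ⟨t, ht⟩
      have h2 := hγ ω' ⟨t, ht⟩
      simp only at h1 h2
      rw [h1, h2, hS]
      simp only [hdev]
  -- every device belongs to some admissible set
  have hmem : ∀ k : Fin m, ∃ S : {S : Finset (Fin m) // S.card = P}, k ∈ S.1 := by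
    intro k
    obtain ⟨S, h1, -, h2⟩ := Finset.exists_subsuperset_card_eq (Finset.subset_univ {k})
      (by simpa using hP1) (show P ≤ (Finset.univ : Finset (Fin m)).card by simpa using hPm)
    exact ⟨⟨S, h2⟩, h1 (by simp)⟩
  choose Sk hSk using hmem
  -- the potential
  obtain ⟨K, hK⟩ : ∃ K : ℝ, K = 10 * L ^ 3 * ((m : ℝ) / P) / α ^ 2 := ⟨_, rfl⟩
  have hK0 : 0 ≤ K := by rw [hK]; positivity
  obtain ⟨V, hV⟩ : ∃ V : (Fin T → {S : Finset (Fin m) // S.card = P}) → ℕ → ℝ,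
    V = fun ω t => ℓ (γ ω t) + K * ((m : ℝ)⁻¹ * ∑ k, ‖θdev ω t k - γ ω t‖ ^ 2) := ⟨_, rfl⟩
  have hstep : ∀ t, t < T →
      ∑ ω, (V ω (t + 1) - V ω t + ‖gradient ℓ (γ ω t)‖ ^ 2 / (3 * α)) ≤ 0 := by
    intro t ht
    apply fd_avg (⟨t, ht⟩ : Fin T)
    intro ω
    have hagree : ∀ S, ∀ s : Fin T, s.1 < t → Function.update ω ⟨t, ht⟩ S s = ω s := by
      intro S s hs
      apply Function.update_of_ne
      intro hc
      rw [hc] at hs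
      exact lt_irrefl _ hs
    have hA := fun S => hadapt t ht.le _ _ (hagree S)
    have hAg : ∀ S k, g (Function.update ω ⟨t, ht⟩ S) t k = g ω t k := fun S k => by
      rw [hgg _ t ht.le, hgg _ t ht.le, (hA S).1]
    have hAθ : ∀ S, θ (Function.update ω ⟨t, ht⟩ S) t = θ ω t := fun S => by
      rw [hθγ _ t ht.le, hθγ _ t ht.le, (hA S).2, hhm _ t ht.le, hhm _ t ht.le]
      simp only [hAg]
    have hfoc' : ∀ S, ∀ k ∈ S.1,
        gradient (Lk k) (θdev (Function.update ω ⟨t, ht⟩ S) (t + 1) k)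
          - gradient (Lk k) (θdev ω t k)
          + α • (θdev (Function.update ω ⟨t, ht⟩ S) (t + 1) k - θ ω t) = 0 := by
      intro S k hk
      have h1 := hfoc (Function.update ω ⟨t, ht⟩ S) ⟨t, ht⟩ k (by simpa using hk)
      simp only at h1
      rwa [hAg, hAθ, hgg ω t ht.le] at h1
    have htd : ∀ S, ∀ k ∈ S.1, θdev (Function.update ω ⟨t, ht⟩ S) (t + 1) k =
        θdev (Function.update ω ⟨t, ht⟩ (Sk k)) (t + 1) k := by
      intro S k hk
      exact huniq k _ _ _ _ (hfoc' S k hk) (hfoc' (Sk k) k (hSk k))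
    have key := fd_step m P hP1 hPm α L hα hL hαc (fun k => gradient (Lk k)) hsmooth ℓ
      (gradient ℓ) hgradℓ hHG' (γ ω t) (θ ω t) (h ω t) (θdev ω t)
      (fun k => θdev (Function.update ω ⟨t, ht⟩ (Sk k)) (t + 1) k)
      (by rw [hhm _ t ht.le]; simp only [hgg ω t ht.le])
      (hθγ ω t ht.le)
      (fun k => hfoc' (Sk k) k (hSk k))
      (fun S => γ (Function.update ω ⟨t, ht⟩ S) (t + 1))
      (fun S => θdev (Function.update ω ⟨t, ht⟩ S) (t + 1))
      (by
        intro S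
        have h1 := hγ (Function.update ω ⟨t, ht⟩ S) ⟨t, ht⟩
        simp only [Function.update_self] at h1
        rw [h1]
        congr 1
        exact Finset.sum_congr rfl fun k hk => htd S k hk)
      htd
      (by
        intro S k hk
        have h1 := hstaleθ (Function.update ω ⟨t, ht⟩ S) ⟨t, ht⟩ k (by simpa using hk)
        simp only at h1
        rw [h1, (hA S).1])
    refine le_trans (le_of_eq ?_) key
    refine Finset.sum_congr rfl fun S _ => ?_
    rw [hV, ← hK]
    simp only [(hA S).1, (hA S).2]
  have htel : ∀ t, t ≤ T → ∑ ω, V ω t +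
      ∑ ω, ∑ s ∈ Finset.range t, ‖gradient ℓ (γ ω s)‖ ^ 2 / (3 * α) ≤ ∑ ω, V ω 0 := by
    intro t
    induction t with
    | zero => intro _; simp
    | succ t ih =>
      intro ht
      have h1 := ih (by omega)
      have h2 := hstep t ht
      simp only [Finset.sum_range_succ, Finset.sum_add_distrib, Finset.sum_sub_distrib] at h1 h2 ⊢
      linarith
  have hfin := htel T le_rfl
  obtain ⟨N, hN⟩ : ∃ N : ℝ,
    N = (Fintype.card (Fin T → {S : Finset (Fin m) // S.card = P}) : ℝ) := ⟨_, rfl⟩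
  have hNpos : 0 < N := by
    rw [hN]
    have : Nonempty (Fin T → {S : Finset (Fin m) // S.card = P}) := ⟨fun _ => Sk ⟨0, hm⟩⟩
    exact_mod_cast Fintype.card_pos
  have hV0 : ∑ ω, V ω 0 = N * (ℓ θ0 + K * ((m : ℝ)⁻¹ * ∑ k, ‖θdev0 k - θ0‖ ^ 2)) := by
    rw [hV]
    simp only [hγ0, hθdev0, Finset.sum_const, Finset.card_univ, nsmul_eq_mul, hN]
  have hVT : N * lstar ≤ ∑ ω, V ω T := by
    have : ∑ ω : (Fin T → {S : Finset (Fin m) // S.card = P}), lstar ≤ ∑ ω, V ω T := by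
      apply Finset.sum_le_sum
      intro ω _
      have h1 : lstar ≤ ℓ (γ ω T) := hglb.1 ⟨_, rfl⟩
      have h2 : 0 ≤ K * ((m : ℝ)⁻¹ * ∑ k, ‖θdev ω T k - γ ω T‖ ^ 2) := by positivity
      rw [hV]
      linarith
    simpa only [Finset.sum_const, Finset.card_univ, nsmul_eq_mul, hN] using this
  rw [← hN, ← Finset.mul_sum, mul_div_assoc]
  apply mul_le_mul_of_nonneg_left _ (by positivity)
  rw [div_le_iff₀ hNpos]
  obtain ⟨C0, hC0⟩ : ∃ C0 : ℝ, C0 = (m : ℝ)⁻¹ * ∑ k, ‖θdev0 k - θ0‖ ^ 2 := ⟨_, rfl⟩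
  rw [← hC0] at hV0 ⊢
  simp only [← Finset.sum_div] at hfin
  obtain ⟨Q, hQ⟩ : ∃ Q : ℝ,
    Q = ∑ ω, ∑ s ∈ Finset.range T, ‖gradient ℓ (γ ω s)‖ ^ 2 := ⟨_, rfl⟩
  rw [← hQ] at hfin ⊢
  have h3 : Q / (3 * α) ≤ N * (ℓ θ0 - lstar + K * C0) := by linarith
  rw [div_le_iff₀ (by positivity)] at h3
  refine h3.trans (le_of_eq ?_)
  rw [hK]
  field_simp
  ring
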